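/- Let N ≥ 2 be an integer. Define for 0 < r < 1 the radial complex eigenvalue density ρ_c(r) = (N(N−1)/(2^{N+1}·π·r²)) · (1/r + r)^{N−2} · (1/r − r) · ∫_{(1/r − r)/2}^{∞} dt/(1+t²)^{N/2+1}, and let E_N = √π·Γ((N+1)/2)/Γ(N/2). Then the total-eigenvalue-number sum rule holds: E_N + 4π·∫_0^1 r·ρ_c(r) dr = N. -/

import Mathlib

open MeasureTheory Real

open Filter in
lemma integrable_one_add_sq_rpow {a : ℝ} (ha : 1 / 2 < a) :
    Integrable (fun t : ℝ ↦ (1 + t ^ 2) ^ (-a)) := by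
  have h := integrable_rpow_neg_one_add_norm_sq (E := ℝ) (μ := volume) (r := 2 * a)
    (by simp; linarith)
  refine h.congr (Eventually.of_forall fun t ↦ ?_)
  simp only [Real.norm_eq_abs, sq_abs]
  congr 1
  ring

lemma continuous_one_add_sq_rpow (a : ℝ) : Continuous (fun t : ℝ ↦ (1 + t ^ 2) ^ a) :=
  Continuous.rpow_const (by fun_prop) fun t ↦ Or.inl (by positivity)

lemma hasDerivAt_mul_one_add_sq_rpow (a t : ℝ) :
    HasDerivAt (fun t : ℝ ↦ t * (1 + t ^ 2) ^ (-a))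
      ((1 - 2 * a) * (1 + t ^ 2) ^ (-a) + 2 * a * (1 + t ^ 2) ^ (-(a + 1))) t := by
  have hpos : 0 < 1 + t ^ 2 := by positivity
  have h1 : HasDerivAt (fun t : ℝ ↦ 1 + t ^ 2) (2 * t) t := by
    simpa using (hasDerivAt_pow 2 t).const_add 1
  refine ((hasDerivAt_id t).mul (h1.rpow_const (p := -a) (Or.inl hpos.ne'))).congr_deriv ?_
  have e : (1 + t ^ 2) ^ (-a) = (1 + t ^ 2) ^ (-(a + 1)) * (1 + t ^ 2) := by
    rw [← rpow_add_one hpos.ne']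
    congr 1
    ring
  have e' : (1 + t ^ 2) ^ (-a - 1) = (1 + t ^ 2) ^ (-(a + 1)) := by
    congr 1
    ring
  simp only [id, e, e']
  ring

open Set Filter Topology in
lemma integral_Ioi_one_add_sq_rpow_add_one {a : ℝ} (ha : 1 ≤ a) :
    2 * a * ∫ t in Ioi (0 : ℝ), (1 + t ^ 2) ^ (-(a + 1)) =
      (2 * a - 1) * ∫ t in Ioi (0 : ℝ), (1 + t ^ 2) ^ (-a) := by
  have i1 := (integrable_one_add_sq_rpow (a := a) (by linarith)).integrableOn (s := Ioi 0)
  have i2 := (integrable_one_add_sq_rpow (a := a + 1) (by linarith)).integrableOn (s := Ioi 0)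
  have hlim : Tendsto (fun t : ℝ ↦ t * (1 + t ^ 2) ^ (-a)) atTop (𝓝 0) := by
    refine squeeze_zero' ?_ ?_ tendsto_inv_atTop_zero
    · filter_upwards [eventually_gt_atTop 0] with t ht
      positivity
    · filter_upwards [eventually_gt_atTop 0] with t ht
      have h : (1 + t ^ 2) ^ (-a) ≤ (1 + t ^ 2) ^ (-1 : ℝ) :=
        rpow_le_rpow_of_exponent_le (by nlinarith [sq_nonneg t]) (by linarith)
      rw [rpow_neg_one] at h
      calc t * (1 + t ^ 2) ^ (-a) ≤ t * (1 + t ^ 2)⁻¹ := by gcongr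
        _ ≤ t⁻¹ := by
          rw [← div_eq_mul_inv, div_le_iff₀ (by positivity)]
          field_simp
          nlinarith
  have h := integral_Ioi_of_hasDerivAt_of_tendsto' (a := 0)
    (fun t _ ↦ hasDerivAt_mul_one_add_sq_rpow a t)
    ((i1.const_mul (1 - 2 * a)).add (i2.const_mul (2 * a))) hlim
  rw [integral_add (i1.const_mul _) (i2.const_mul _), integral_const_mul, integral_const_mul] at h
  simp only [zero_mul, sub_zero] at h
  linarith

open Set Filter Topology in
lemma integral_Ioi_one_add_sq_rpow_three_halves :
    ∫ t in Ioi (0 : ℝ), (1 + t ^ 2) ^ (-(3 / 2) : ℝ) = 1 := by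
  have hd : ∀ t ∈ Ici (0 : ℝ), HasDerivAt (fun t : ℝ ↦ t * (1 + t ^ 2) ^ (-(1 / 2) : ℝ))
      ((1 + t ^ 2) ^ (-(3 / 2) : ℝ)) t := fun t _ ↦ by
    have h := hasDerivAt_mul_one_add_sq_rpow (1 / 2) t
    norm_num at h ⊢
    exact h
  have hlim : Tendsto (fun t : ℝ ↦ t * (1 + t ^ 2) ^ (-(1 / 2) : ℝ)) atTop (𝓝 1) := by
    have h1 : Tendsto (fun t : ℝ ↦ √(1 - (1 + t ^ 2)⁻¹)) atTop (𝓝 (√(1 - 0))) := by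
      refine (continuous_sqrt.tendsto _).comp (tendsto_const_nhds.sub ?_)
      exact tendsto_inv_atTop_zero.comp
        (tendsto_atTop_add_const_left _ _ (tendsto_pow_atTop two_ne_zero))
    rw [sub_zero, sqrt_one] at h1
    refine h1.congr' ?_
    filter_upwards [eventually_gt_atTop 0] with t ht
    have e : 1 - (1 + t ^ 2)⁻¹ = t ^ 2 / (1 + t ^ 2) := by
      field_simp
      ring
    rw [e, sqrt_div (by positivity), sqrt_sq ht.le, rpow_neg (by positivity), ← sqrt_eq_rpow,
      div_eq_mul_inv]
  have h := integral_Ioi_of_hasDerivAt_of_tendsto' hd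
    (integrable_one_add_sq_rpow (a := 3 / 2) (by norm_num)).integrableOn hlim
  simpa using h

open Set in
lemma integral_Ioi_one_add_sq_rpow_eq_Gamma (n : ℕ) :
    ∫ t in Ioi (0 : ℝ), (1 + t ^ 2) ^ (-((n : ℝ) / 2 + 1)) =
      √π / 2 * Gamma (((n : ℝ) + 1) / 2) / Gamma ((n : ℝ) / 2 + 1) := by
  induction n using Nat.twoStepInduction with
  | zero =>
    simp only [Nat.cast_zero, zero_div, zero_add, Gamma_one, Gamma_one_half_eq, rpow_neg_one]
    rw [integral_Ioi_inv_one_add_sq, arctan_zero]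
    have := mul_self_sqrt pi_pos.le
    linarith
  | one =>
    have e : (-(((1 : ℕ) : ℝ) / 2 + 1)) = -(3 / 2) := by norm_num
    rw [e, integral_Ioi_one_add_sq_rpow_three_halves, Nat.cast_one,
      Gamma_add_one (by norm_num), Gamma_one_half_eq]
    norm_num
    field_simp
  | more n ih _ =>
    have h := integral_Ioi_one_add_sq_rpow_add_one (a := (n : ℝ) / 2 + 1)
      (by linarith [(Nat.cast_nonneg n : (0 : ℝ) ≤ n)])
    have e1 : (((n + 2 : ℕ) : ℝ) + 1) / 2 = ((n : ℝ) + 1) / 2 + 1 := by push_cast; ring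
    have e2 : (((n + 2 : ℕ) : ℝ) / 2 + 1) = ((n : ℝ) / 2 + 1) + 1 := by push_cast; ring
    rw [e1, e2, Gamma_add_one (by positivity), Gamma_add_one (s := (n : ℝ) / 2 + 1) (by positivity)]
    rw [ih] at h
    have hG : Gamma ((n : ℝ) / 2 + 1) ≠ 0 := (Gamma_pos_of_pos (by positivity)).ne'
    have hn : (0 : ℝ) < 2 * ((n : ℝ) / 2 + 1) := by positivity
    apply mul_left_cancel₀ hn.ne'
    rw [h]
    field_simp
    ring

open Set in
lemma hasDerivAt_integral_Ioi {f : ℝ → ℝ} (hf : Integrable f) (hc : Continuous f) (u : ℝ) :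
    HasDerivAt (fun u ↦ ∫ t in Ioi u, f t) (-f u) u := by
  have e : (fun u ↦ ∫ t in Ioi u, f t) =
      fun u ↦ (∫ t in Ioi (0 : ℝ), f t) - ∫ t in (0 : ℝ)..u, f t := by
    ext v
    have h := intervalIntegral.integral_interval_add_Ioi (hf.integrableOn (s := Ioi 0))
      (hf.integrableOn (s := Ioi v))
    linarith
  rw [e]
  exact (intervalIntegral.integral_hasDerivAt_right (hc.intervalIntegrable _ _)
    hc.aestronglyMeasurable.stronglyMeasurableAtFilter hc.continuousAt).const_sub _

open Set in
lemma integral_Ioi_one_add_sq_rpow_le {N : ℕ} {u s : ℝ} (hu : 0 ≤ u) (hs : 0 < s)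
    (hsu : 1 + u ^ 2 = s ^ 2) :
    ∫ t in Ioi u, (1 + t ^ 2) ^ (-((N : ℝ) / 2 + 1)) ≤ (s ^ N)⁻¹ * π := by
  have hN : (0 : ℝ) ≤ N := Nat.cast_nonneg N
  calc ∫ t in Ioi u, (1 + t ^ 2) ^ (-((N : ℝ) / 2 + 1))
      ≤ ∫ t in Ioi u, (s ^ N)⁻¹ * (1 + t ^ 2)⁻¹ := by
        refine setIntegral_mono_on (integrable_one_add_sq_rpow (by linarith)).integrableOn
          (integrable_inv_one_add_sq.integrableOn.const_mul _) measurableSet_Ioi fun t ht ↦ ?_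
        have hpos : 0 < 1 + t ^ 2 := by positivity
        have hle : s ^ 2 ≤ 1 + t ^ 2 := by
          rw [← hsu]
          have := mem_Ioi.1 ht
          gcongr
        have h1 : (1 + t ^ 2) ^ (-((N : ℝ) / 2 + 1)) =
            (1 + t ^ 2) ^ (-((N : ℝ) / 2)) * (1 + t ^ 2)⁻¹ := by
          rw [← rpow_neg_one (1 + t ^ 2), ← rpow_add hpos]
          congr 1
          ring
        have h2 : (s ^ N)⁻¹ = (s ^ 2) ^ (-((N : ℝ) / 2)) := by
          rw [← rpow_natCast s 2, ← rpow_mul hs.le, ← rpow_natCast s N, ← rpow_neg hs.le]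
          congr 1
          push_cast
          ring
        rw [h1, h2]
        gcongr ?_ * _
        exact rpow_le_rpow_of_nonpos (by positivity) hle (by linarith)
    _ = (s ^ N)⁻¹ * ∫ t in Ioi u, (1 + t ^ 2)⁻¹ := integral_const_mul _ _
    _ ≤ (s ^ N)⁻¹ * π := by
        gcongr
        rw [integral_Ioi_inv_one_add_sq]
        linarith [arctan_nonneg.2 hu, pi_pos]

/-- An antiderivative of `4 π r ρ_c(r)`; its junk value at `0` is its limit there. -/
noncomputable def complexMassPrimitive (N : ℕ) (r : ℝ) : ℝ :=
  -N * (((1 / r + r) / 2) ^ (N - 1) *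
    (∫ t in Set.Ioi ((1 / r - r) / 2), (1 + t ^ 2) ^ (-((N : ℝ) / 2 + 1))) +
      (1 - r ^ 2) / (1 + r ^ 2))

lemma complexMassPrimitive_zero {N : ℕ} (hN : 2 ≤ N) : complexMassPrimitive N 0 = -N := by
  have : N - 1 ≠ 0 := by omega
  simp [complexMassPrimitive, this]

lemma hasDerivAt_complexMassPrimitive {N : ℕ} (hN : 2 ≤ N) {r : ℝ} (hr : 0 < r) :
    HasDerivAt (complexMassPrimitive N)
      (4 * π * (r * (((N : ℝ) * ((N : ℝ) - 1) / (2 ^ (N + 1) * π * r ^ 2)) *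
        (1 / r + r) ^ (N - 2) * (1 / r - r) *
        ∫ t in Set.Ioi ((1 / r - r) / 2), (1 + t ^ 2) ^ (-((N : ℝ) / 2 + 1))))) r := by
  obtain ⟨M, rfl⟩ := Nat.exists_eq_add_of_le' hN
  set a : ℝ := ((M + 2 : ℕ) : ℝ) / 2 + 1 with ha
  have hs : HasDerivAt (fun r : ℝ ↦ (1 / r + r) / 2) ((-(r ^ 2)⁻¹ + 1) / 2) r := by
    simpa [one_div] using ((hasDerivAt_inv hr.ne').add (hasDerivAt_id r)).div_const 2
  have hu : HasDerivAt (fun r : ℝ ↦ (1 / r - r) / 2) ((-(r ^ 2)⁻¹ - 1) / 2) r := by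
    simpa [one_div] using ((hasDerivAt_inv hr.ne').sub (hasDerivAt_id r)).div_const 2
  have hg := (hasDerivAt_integral_Ioi (integrable_one_add_sq_rpow (a := a)
    (by rw [ha]; push_cast; linarith [(Nat.cast_nonneg M : (0 : ℝ) ≤ M)]))
    (continuous_one_add_sq_rpow _) ((1 / r - r) / 2)).comp r hu
  have hq : HasDerivAt (fun r : ℝ ↦ (1 - r ^ 2) / (1 + r ^ 2))
      (((-(2 * r)) * (1 + r ^ 2) - (1 - r ^ 2) * (2 * r)) / (1 + r ^ 2) ^ 2) r := by
    have h2 : HasDerivAt (fun r : ℝ ↦ r ^ 2) (2 * r) r := by simpa using hasDerivAt_pow 2 r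
    exact (h2.const_sub 1).div (h2.const_add 1) (by positivity)
  have hpow : (1 + ((1 / r - r) / 2) ^ 2) ^ (-a) = (((1 / r + r) / 2) ^ (M + 4))⁻¹ := by
    have e : 1 + ((1 / r - r) / 2) ^ 2 = ((1 / r + r) / 2) ^ 2 := by
      field_simp
      ring
    have hpos : 0 ≤ (1 / r + r) / 2 := by positivity
    rw [e, ← rpow_natCast _ 2, ← rpow_mul hpos, ← rpow_natCast _ (M + 4), ← rpow_neg hpos]
    congr 1
    rw [ha]
    push_cast
    ring
  refine ((((hs.pow (M + 1)).mul hg).add hq).const_mul (-((M + 2 : ℕ) : ℝ))).congr_deriv ?_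
  simp only [Function.comp, hpow, Pi.pow_apply]
  generalize (∫ t in Set.Ioi ((1 / r - r) / 2), (1 + t ^ 2) ^ (-a)) = G
  have hsr : (1 / r + r) = (1 + r ^ 2) / r := by field_simp
  simp only [hsr, Nat.add_sub_cancel, div_pow]
  have h1 : (0 : ℝ) < 1 + r ^ 2 := by positivity
  have hpi := pi_pos
  push_cast
  field_simp
  ring

open Set Filter Topology in
lemma tendsto_complexMassPrimitive {N : ℕ} (hN : 2 ≤ N) :
    Tendsto (complexMassPrimitive N) (𝓝[>] 0) (𝓝 (complexMassPrimitive N 0)) := by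
  have hq : Tendsto (fun r : ℝ ↦ (1 - r ^ 2) / (1 + r ^ 2)) (𝓝[>] 0) (𝓝 1) := by
    have : ContinuousAt (fun r : ℝ ↦ (1 - r ^ 2) / (1 + r ^ 2)) 0 :=
      ContinuousAt.div (by fun_prop) (by fun_prop) (by norm_num)
    simpa using this.tendsto.mono_left nhdsWithin_le_nhds
  have hz : Tendsto (fun r : ℝ ↦ ((1 / r + r) / 2) ^ (N - 1) *
      (∫ t in Ioi ((1 / r - r) / 2), (1 + t ^ 2) ^ (-((N : ℝ) / 2 + 1)))) (𝓝[>] 0) (𝓝 0) := by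
    have hb : Tendsto (fun r : ℝ ↦ 2 * π * r) (𝓝[>] 0) (𝓝 0) := by
      have : ContinuousAt (fun r : ℝ ↦ 2 * π * r) 0 := by fun_prop
      simpa using this.tendsto.mono_left nhdsWithin_le_nhds
    refine squeeze_zero' ?_ ?_ hb
    · filter_upwards [self_mem_nhdsWithin] with r hr
      have hr : 0 < r := hr
      exact mul_nonneg (by positivity) (integral_nonneg fun t ↦ by positivity)
    · filter_upwards [Ioo_mem_nhdsGT (zero_lt_one' ℝ)] with r hr
      have hr0 : 0 < r := hr.1
      have hs : 0 < (1 / r + r) / 2 := by positivity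
      have hu : 0 ≤ (1 / r - r) / 2 := by
        have : 1 ≤ 1 / r := by rw [le_div_iff₀ hr0]; linarith [hr.2]
        linarith [hr.2]
      have hle := integral_Ioi_one_add_sq_rpow_le (N := N) hu hs (by field_simp; ring)
      calc _ ≤ ((1 / r + r) / 2) ^ (N - 1) * ((((1 / r + r) / 2) ^ N)⁻¹ * π) := by gcongr
        _ = π / ((1 / r + r) / 2) := by
          obtain ⟨M, rfl⟩ := Nat.exists_eq_add_of_le' hN
          rw [show M + 2 - 1 = M + 1 by omega, pow_succ _ (M + 1)]
          generalize (1 / r + r) / 2 = s at hs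
          field_simp
        _ ≤ 2 * π * r := by
          rw [div_le_iff₀ hs]
          have e : 2 * π * r * ((1 / r + r) / 2) = π * (1 + r ^ 2) := by field_simp
          rw [e]
          nlinarith [pi_pos, sq_nonneg r, mul_nonneg pi_pos.le (sq_nonneg r)]
  rw [complexMassPrimitive_zero hN]
  have h := (hz.add hq).const_mul (-(N : ℝ))
  rwa [zero_add, mul_one] at h

/-- Sum rule for the total number of eigenvalues of the real spherical ensemble: the expected
number of real eigenvalues `E_N = √π Γ((N+1)/2)/Γ(N/2)` plus twice the total mass of the
complex eigenvalue density `ρ_c` in the unit disk equals `N`. -/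
theorem stmt_12 (N : ℕ) (hN : 2 ≤ N)
    (ρc : ℝ → ℝ)
    (hρ : ∀ r : ℝ, ρc r =
      ((N : ℝ) * ((N : ℝ) - 1) / (2 ^ (N + 1) * π * r ^ 2)) *
        (1 / r + r) ^ (N - 2) * (1 / r - r) *
        ∫ t in Set.Ioi ((1 / r - r) / 2), (1 + t ^ 2) ^ (-((N : ℝ) / 2 + 1))) :
    Real.sqrt π * Gamma (((N : ℝ) + 1) / 2) / Gamma ((N : ℝ) / 2) +
      4 * π * ∫ r in (0:ℝ)..1, r * ρc r = N := by
  have hderiv : ∀ r : ℝ, 0 < r →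
      HasDerivAt (complexMassPrimitive N) (4 * π * (r * ρc r)) r := fun r hr ↦ by
    rw [hρ r]
    exact hasDerivAt_complexMassPrimitive hN hr
  have hcont : ContinuousOn (complexMassPrimitive N) (Set.Icc 0 1) := by
    intro r hr
    rcases hr.1.eq_or_lt with rfl | h
    · have h0 : ContinuousWithinAt (complexMassPrimitive N) (Set.Ioi 0) 0 :=
        tendsto_complexMassPrimitive hN
      exact (continuousWithinAt_Ioi_iff_Ici.1 h0).mono Set.Icc_subset_Ici_self
    · exact (hderiv r h).continuousAt.continuousWithinAt
  have hN' : (2 : ℝ) ≤ N := by exact_mod_cast hN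
  have hnonneg : ∀ r ∈ Set.Ioo (0 : ℝ) 1, 0 ≤ 4 * π * (r * ρc r) := fun r hr ↦ by
    have hr0 : 0 < r := hr.1
    have h1 : 1 ≤ 1 / r := by rw [le_div_iff₀ hr0]; linarith [hr.2]
    have h2 : 0 ≤ 1 / r - r := by linarith [hr.2]
    have h3 : (0 : ℝ) ≤ (N : ℝ) - 1 := by linarith
    have h4 : 0 ≤ ∫ t in Set.Ioi ((1 / r - r) / 2), (1 + t ^ 2) ^ (-((N : ℝ) / 2 + 1)) :=
      integral_nonneg fun t ↦ by positivity
    rw [hρ r]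
    positivity
  have hint := intervalIntegral.integrableOn_deriv_of_nonneg hcont
    (fun r hr ↦ hderiv r hr.1) hnonneg
  have hmain := intervalIntegral.integral_eq_sub_of_hasDerivAt_of_le zero_le_one hcont
    (fun r hr ↦ hderiv r hr.1)
    ((intervalIntegrable_iff_integrableOn_Ioc_of_le zero_le_one).2 hint)
  rw [intervalIntegral.integral_const_mul] at hmain
  rw [hmain]
  have h1 : complexMassPrimitive N 1 =
      -N * (√π / 2 * Gamma (((N : ℝ) + 1) / 2) / Gamma ((N : ℝ) / 2 + 1)) := by
    rw [← integral_Ioi_one_add_sq_rpow_eq_Gamma]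
    norm_num [complexMassPrimitive]
  rw [complexMassPrimitive_zero hN, h1, Gamma_add_one (by positivity)]
  have hG : Gamma ((N : ℝ) / 2) ≠ 0 := (Gamma_pos_of_pos (by positivity)).ne'
  field_simp
  ring
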